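/- Let a, b, c, c', d, e be complex numbers with Re(d+e-a-b-c) > 0 and Re(e-c-c') > 0 (and no denominator parameter a nonpositive integer). Setting e' = d+e-a-b-c, a' = d-a, b' = d-b, the Kampé de Fériet series Σ_{m,n≥0} (a)_m(b)_m(c)_m (a')_n(b')_n(c')_n / ((d)_{m+n}(e)_m(e')_n m! n!) equals (Γ(e)Γ(e')/(Γ(e-c)Γ(e'+c))) · ₃F₂[d-a, d-b, c+c'; d, e'+c; 1]. -/

import Mathlib

open Complex Finset

/-- Pochhammer symbol `(a)_k = a(a+1)⋯(a+k-1)`. -/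
noncomputable def poch (a : ℂ) (k : ℕ) : ℂ := ∏ i ∈ Finset.range k, (a + i)

/-- `z` is not a nonpositive integer. -/
def notNonposInt (z : ℂ) : Prop := ∀ k : ℕ, z ≠ -(k : ℂ)

open Filter Topology

lemma poch_zero (a : ℂ) : poch a 0 = 1 := by simp [poch]

lemma poch_succ (a : ℂ) (k : ℕ) : poch a (k + 1) = poch a k * (a + k) := by
  simp [poch, Finset.prod_range_succ]

lemma poch_add (a : ℂ) (n j : ℕ) : poch a (n + j) = poch a n * poch (a + n) j := by
  simp only [poch, Finset.prod_range_add]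
  congr 1
  apply Finset.prod_congr rfl
  intro i _
  push_cast
  ring

lemma nn_ne {z : ℂ} (hz : notNonposInt z) (k : ℕ) : z + k ≠ 0 := fun h =>
  hz k (eq_neg_of_add_eq_zero_left h)

lemma nn_add {z : ℂ} (hz : notNonposInt z) (n : ℕ) : notNonposInt (z + n) := fun k h => by
  apply nn_ne hz (n + k)
  push_cast
  rw [← add_assoc, h]
  ring

lemma nn_of_re {z : ℂ} (hz : 0 < z.re) : notNonposInt z := fun k h => by
  have := congrArg Complex.re h
  simp at this
  have : (0 : ℝ) ≤ k := Nat.cast_nonneg k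
  linarith

lemma poch_ne {z : ℂ} (hz : notNonposInt z) (k : ℕ) : poch z k ≠ 0 :=
  Finset.prod_ne_zero_iff.mpr fun i _ => nn_ne hz i

lemma fac_ne (k : ℕ) : (Nat.factorial k : ℂ) ≠ 0 := Nat.cast_ne_zero.mpr (Nat.factorial_ne_zero k)

lemma poch_gamma {z : ℂ} (hz : notNonposInt z) (k : ℕ) :
    Complex.Gamma (z + k) = poch z k * Complex.Gamma z := by
  induction k with
  | zero => simp [poch_zero]
  | succ k ih =>
    have : z + (k + 1 : ℕ) = (z + k) + 1 := by push_cast; ring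
    rw [this, Complex.Gamma_add_one _ (nn_ne hz k), ih, poch_succ]
    ring

lemma gamma_ne {z : ℂ} (hz : notNonposInt z) : Complex.Gamma z ≠ 0 :=
  Complex.Gamma_ne_zero hz

/-- Vandermonde convolution. -/
lemma vandermonde (c c' : ℂ) (n : ℕ) :
    ∑ p ∈ antidiagonal n, (poch c p.1 / (p.1.factorial : ℂ)) * (poch c' p.2 / (p.2.factorial : ℂ))
      = poch (c + c') n / (n.factorial : ℂ) := by
  induction n with
  | zero => simp [poch_zero]
  | succ n ih =>
    have key : ((n : ℂ) + 1) * ∑ p ∈ antidiagonal (n + 1),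
        (poch c p.1 / (p.1.factorial : ℂ)) * (poch c' p.2 / (p.2.factorial : ℂ))
        = (c + c' + n) * ∑ p ∈ antidiagonal n,
        (poch c p.1 / (p.1.factorial : ℂ)) * (poch c' p.2 / (p.2.factorial : ℂ)) := by
      have h1 : ((n : ℂ) + 1) * ∑ p ∈ antidiagonal (n + 1),
        (poch c p.1 / (p.1.factorial : ℂ)) * (poch c' p.2 / (p.2.factorial : ℂ))
        = ∑ p ∈ antidiagonal (n + 1),
          (p.1 : ℂ) * ((poch c p.1 / (p.1.factorial : ℂ)) * (poch c' p.2 / (p.2.factorial : ℂ)))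
          + ∑ p ∈ antidiagonal (n + 1),
          (p.2 : ℂ) * ((poch c p.1 / (p.1.factorial : ℂ)) * (poch c' p.2 / (p.2.factorial : ℂ))) := by
        rw [Finset.mul_sum, ← Finset.sum_add_distrib]
        refine Finset.sum_congr rfl fun p hp => ?_
        have : ((p.1 : ℂ) + p.2) = n + 1 := by exact_mod_cast mem_antidiagonal.mp hp
        rw [← this]; ring
      rw [h1, Finset.Nat.sum_antidiagonal_succ, Finset.Nat.sum_antidiagonal_succ']
      simp only [Nat.cast_zero, zero_mul, zero_add]
      rw [← Finset.sum_add_distrib, Finset.mul_sum]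
      refine Finset.sum_congr rfl fun p hp => ?_
      have : ((p.1 : ℂ) + p.2) = n := by exact_mod_cast mem_antidiagonal.mp hp
      rw [← this, poch_succ, poch_succ, Nat.factorial_succ, Nat.factorial_succ]
      have h1 := fac_ne p.1
      have h2 := fac_ne p.2
      have h3 : (p.1 : ℂ) + 1 ≠ 0 := Nat.cast_add_one_ne_zero _
      have h4 : (p.2 : ℂ) + 1 ≠ 0 := Nat.cast_add_one_ne_zero _
      push_cast
      field_simp
      ring
    rw [ih] at key
    have h3 : (n : ℂ) + 1 ≠ 0 := Nat.cast_add_one_ne_zero _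
    apply mul_left_cancel₀ h3
    rw [key, poch_succ, Nat.factorial_succ]
    have := fac_ne n
    push_cast
    field_simp

/-- Pfaff–Saalschütz in the form of Euler. -/
lemma saalschutz (a b D : ℂ) (hD : notNonposInt D) (n : ℕ) :
    ∑ p ∈ antidiagonal n, (poch a p.1 * poch b p.1 / (poch D p.1 * (p.1.factorial : ℂ))) *
        (poch (D - a - b) p.2 / (p.2.factorial : ℂ))
      = poch (D - a) n * poch (D - b) n / (poch D n * (n.factorial : ℂ)) := by
  induction n with
  | zero => simp [poch_zero]
  | succ n ih =>
    set F : ℕ × ℕ → ℂ := fun p => (poch a p.1 * poch b p.1 / (poch D p.1 * (p.1.factorial : ℂ))) *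
        (poch (D - a - b) p.2 / (p.2.factorial : ℂ)) with hF
    have key : (D + n) * ((n : ℂ) + 1) * ∑ p ∈ antidiagonal (n + 1), F p
        = (D - a + n) * (D - b + n) * ∑ p ∈ antidiagonal n, F p := by
      have h1 : (D + n) * ((n : ℂ) + 1) * ∑ p ∈ antidiagonal (n + 1), F p
        = ∑ p ∈ antidiagonal (n + 1), (p.1 : ℂ) * (D + p.1 - 1) * F p
          + ∑ p ∈ antidiagonal (n + 1), (p.2 : ℂ) * (D + 2 * p.1 + p.2 - 1) * F p := by
        rw [Finset.mul_sum, ← Finset.sum_add_distrib]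
        refine Finset.sum_congr rfl fun p hp => ?_
        have : (n : ℂ) = p.1 + p.2 - 1 := by
          rw [eq_sub_iff_add_eq]
          exact_mod_cast (mem_antidiagonal.mp hp).symm
        rw [this]; ring
      rw [h1, Finset.Nat.sum_antidiagonal_succ, Finset.Nat.sum_antidiagonal_succ']
      simp only [Nat.cast_zero, zero_mul, zero_add]
      rw [← Finset.sum_add_distrib, Finset.mul_sum]
      refine Finset.sum_congr rfl fun p hp => ?_
      have : ((p.1 : ℂ) + p.2) = n := by exact_mod_cast mem_antidiagonal.mp hp
      simp only [hF]
      rw [← this, poch_succ, poch_succ, poch_succ, poch_succ, Nat.factorial_succ, Nat.factorial_succ]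
      have h1 := fac_ne p.1
      have h2 := fac_ne p.2
      have h3 : (p.1 : ℂ) + 1 ≠ 0 := Nat.cast_add_one_ne_zero _
      have h4 : (p.2 : ℂ) + 1 ≠ 0 := Nat.cast_add_one_ne_zero _
      have h5 := poch_ne hD p.1
      have h6 := nn_ne hD p.1
      push_cast
      field_simp
      ring
    rw [ih] at key
    have h3 : (n : ℂ) + 1 ≠ 0 := Nat.cast_add_one_ne_zero _
    apply mul_left_cancel₀ (mul_ne_zero (nn_ne hD n) h3)
    rw [key, poch_succ, poch_succ, poch_succ, Nat.factorial_succ]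
    have := fac_ne n
    have h5 := poch_ne hD n
    have h6 := nn_ne hD n
    push_cast
    field_simp

lemma poch_ratio_tendsto (s : ℂ) : ∃ L : ℝ, (notNonposInt s → 0 < L) ∧
    Tendsto (fun k : ℕ => ‖poch s k‖ / ((k.factorial : ℝ) * ((k : ℝ) + 1) ^ (s.re - 1)))
      atTop (𝓝 L) := by
  by_cases hs : notNonposInt s
  · have hG := gamma_ne hs
    refine ⟨‖Complex.Gamma s‖⁻¹, fun _ => by positivity, ?_⟩
    rw [← tendsto_add_atTop_iff_nat 1]
    have h1 := (Complex.GammaSeq_tendsto_Gamma s).norm.inv₀ (norm_ne_zero_iff.mpr hG)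
    have h2 : Tendsto (fun n : ℕ => (1 + 1 / (n : ℝ))⁻¹ * (1 + 2 / (n : ℝ)) ^ (1 - s.re)) atTop
        (𝓝 1) := by
      have e1 : Tendsto (fun n : ℕ => (1 + 1 / (n : ℝ))⁻¹) atTop (𝓝 1) := by
        have := (tendsto_const_nhds (x := (1 : ℝ))).add (tendsto_const_div_atTop_nhds_zero_nat (1 : ℝ))
        simpa using this.inv₀ (by norm_num)
      have e2 : Tendsto (fun n : ℕ => (1 + 2 / (n : ℝ)) ^ (1 - s.re)) atTop (𝓝 1) := by
        have := (tendsto_const_nhds (x := (1 : ℝ))).add (tendsto_const_div_atTop_nhds_zero_nat (2 : ℝ))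
        have := this.rpow_const (p := 1 - s.re) (Or.inl (by norm_num))
        simpa using this
      simpa using e1.mul e2
    have h3 := h1.mul h2
    rw [mul_one] at h3
    refine h3.congr' ?_
    filter_upwards [eventually_gt_atTop 0] with n hn
    have hn' : (0 : ℝ) < n := by exact_mod_cast hn
    have hp : (∏ j ∈ Finset.range (n + 1), (s + j)) = poch s (n + 1) := rfl
    rw [Complex.GammaSeq, hp, norm_div, norm_mul, Complex.norm_natCast_cpow_of_pos hn,
      Nat.factorial_succ]
    have e3 : (1 + 2 / (n : ℝ)) = (n + 2) / n := by field_simp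
    have e4 : (((n + 1 : ℕ) : ℝ) + 1) = n + 2 := by push_cast; ring
    rw [e3, e4, Real.div_rpow (by positivity) (by positivity), Complex.norm_natCast,
      Real.rpow_sub hn', Real.rpow_sub (by positivity : (0 : ℝ) < n + 2),
      Real.rpow_sub (by positivity : (0 : ℝ) < n + 2)]
    simp only [Real.rpow_one]
    have p1 : (0 : ℝ) < (n : ℝ) ^ s.re := Real.rpow_pos_of_pos hn' _
    have p2 : (0 : ℝ) < ((n : ℝ) + 2) ^ s.re := Real.rpow_pos_of_pos (by positivity) _
    have p3 : (0 : ℝ) < (n.factorial : ℝ) := by positivity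
    push_cast
    field_simp
  · refine ⟨0, fun h => absurd h hs, ?_⟩
    simp only [notNonposInt, not_forall, not_not] at hs
    obtain ⟨k, hk⟩ := hs
    refine tendsto_const_nhds.congr' ?_
    filter_upwards [eventually_gt_atTop k] with n hn
    have : poch s n = 0 := Finset.prod_eq_zero (Finset.mem_range.mpr hn) (by rw [hk]; ring)
    simp [this]

lemma poch_upper (s : ℂ) : ∃ C : ℝ, 0 < C ∧ ∀ k : ℕ,
    ‖poch s k‖ ≤ C * ((k.factorial : ℝ) * ((k : ℝ) + 1) ^ (s.re - 1)) := by
  obtain ⟨L, -, hL⟩ := poch_ratio_tendsto s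
  obtain ⟨B, hB⟩ := hL.bddAbove_range
  refine ⟨max B 1, by positivity, fun k => ?_⟩
  have := hB (Set.mem_range_self k)
  have hp : 0 < ((k.factorial : ℝ) * ((k : ℝ) + 1) ^ (s.re - 1)) := by positivity
  rw [div_le_iff₀ hp] at this
  exact this.trans (by gcongr; exact le_max_left _ _)

lemma poch_lower {s : ℂ} (hs : notNonposInt s) : ∃ C : ℝ, 0 < C ∧ ∀ k : ℕ,
    ‖poch s k‖⁻¹ ≤ C * ((k.factorial : ℝ)⁻¹ * ((k : ℝ) + 1) ^ (1 - s.re)) := by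
  obtain ⟨L, hL0, hL⟩ := poch_ratio_tendsto s
  obtain ⟨B, hB⟩ := (hL.inv₀ (hL0 hs).ne').bddAbove_range
  refine ⟨max B 1, by positivity, fun k => ?_⟩
  have := hB (Set.mem_range_self k)
  have hp : 0 < ((k.factorial : ℝ) * ((k : ℝ) + 1) ^ (s.re - 1)) := by positivity
  have hq : 0 < ‖poch s k‖ := norm_pos_iff.mpr (poch_ne hs k)
  have e : ((k : ℝ) + 1) ^ (1 - s.re) = (((k : ℝ) + 1) ^ (s.re - 1))⁻¹ := by
    rw [← Real.rpow_neg (by positivity)]; congr 1; ring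
  simp only [inv_div] at this
  rw [div_le_iff₀ hq] at this
  rw [e, ← mul_inv, ← div_eq_mul_inv, inv_le_iff_one_le_mul₀ hq, div_mul_eq_mul_div, le_div_iff₀ hp,
    one_mul]
  exact this.trans (by gcongr; exact le_max_left _ _)

lemma summable_pow {s : ℝ} (hs : s < -1) : Summable (fun k : ℕ => ((k : ℝ) + 1) ^ s) := by
  have := (summable_nat_add_iff 1).mpr (Real.summable_nat_rpow.mpr hs)
  simpa using this

lemma summable_pow_geom (β : ℝ) :
    Summable (fun k : ℕ => ((k : ℝ) + 1) ^ β * (1 / 2 : ℝ) ^ k) := by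
  obtain ⟨N, hN⟩ := exists_nat_gt β
  have h : Summable (fun k : ℕ => ((k : ℝ) + 1) ^ N * (1 / 2 : ℝ) ^ k) := by
    have h0 := summable_pow_mul_geometric_of_norm_lt_one (R := ℝ) N (r := 1 / 2)
      (by rw [Real.norm_eq_abs, abs_of_pos] <;> norm_num)
    have := ((summable_nat_add_iff 1).mpr h0).mul_left 2
    refine this.congr fun k => ?_
    rw [pow_succ]; push_cast; ring
  refine Summable.of_nonneg_of_le (fun k => by positivity) (fun k => ?_) h
  gcongr
  rw [← Real.rpow_natCast]
  apply Real.rpow_le_rpow_of_exponent_le _ hN.le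
  have : (0 : ℝ) ≤ k := by positivity
  linarith

lemma fac_bound (m n : ℕ) (h : n ≤ m) :
    (m.factorial : ℝ) * n.factorial / ((m + n).factorial : ℝ) ≤ (1 / 2 : ℝ) ^ n := by
  have key : m.factorial * n.factorial * 2 ^ n ≤ (m + n).factorial := by
    induction n with
    | zero => simp
    | succ n ih =>
      have := ih (by omega)
      rw [← add_assoc, Nat.factorial_succ, Nat.factorial_succ, pow_succ]
      calc m.factorial * ((n + 1) * n.factorial) * (2 ^ n * 2)
          = (2 * (n + 1)) * (m.factorial * n.factorial * 2 ^ n) := by ring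
        _ ≤ (m + n + 1) * (m + n).factorial := Nat.mul_le_mul (by omega) this
  have key' : (m.factorial : ℝ) * n.factorial * 2 ^ n ≤ (m + n).factorial := by exact_mod_cast key
  rw [div_le_iff₀ (by positivity), one_div, inv_pow, ← div_eq_inv_mul, le_div_iff₀ (by positivity)]
  exact key'

lemma pow_compare (γ : ℝ) : ∃ C : ℝ, 0 < C ∧ ∀ m n : ℕ, n ≤ m →
    ((m : ℝ) + n + 1) ^ γ ≤ C * ((m : ℝ) + 1) ^ γ := by
  refine ⟨max 1 (2 ^ γ), by positivity, fun m n h => ?_⟩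
  have hn : (n : ℝ) ≤ m := by exact_mod_cast h
  have hn0 : (0 : ℝ) ≤ n := by positivity
  rcases le_or_gt 0 γ with hγ | hγ
  · calc ((m : ℝ) + n + 1) ^ γ ≤ (2 * ((m : ℝ) + 1)) ^ γ := by gcongr; linarith
      _ = 2 ^ γ * ((m : ℝ) + 1) ^ γ := Real.mul_rpow (by norm_num) (by positivity)
      _ ≤ _ := by gcongr; exact le_max_right _ _
  · calc ((m : ℝ) + n + 1) ^ γ ≤ ((m : ℝ) + 1) ^ γ :=
          Real.rpow_le_rpow_of_nonpos (by positivity) (by linarith) hγ.le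
      _ = 1 * ((m : ℝ) + 1) ^ γ := (one_mul _).symm
      _ ≤ _ := by gcongr; exact le_max_left _ _

lemma summable_double {α β γ : ℝ} (h1 : α + γ < -1) (h2 : β + γ < -1) :
    Summable (fun p : ℕ × ℕ => ((p.1.factorial : ℝ) * p.2.factorial / ((p.1 + p.2).factorial : ℝ)) *
      (((p.1 : ℝ) + 1) ^ α * ((p.2 : ℝ) + 1) ^ β * ((p.1 : ℝ) + p.2 + 1) ^ γ)) := by
  obtain ⟨C, hC, hb⟩ := pow_compare γ
  have s1 := (((summable_pow h1).mul_of_nonneg (summable_pow_geom β) (fun _ => by positivity)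
    (fun _ => by positivity)).mul_left C)
  have s2 := (((summable_pow_geom α).mul_of_nonneg (summable_pow h2) (fun _ => by positivity)
    (fun _ => by positivity)).mul_left C)
  refine Summable.of_nonneg_of_le (fun p => by positivity) (fun p => ?_) (s1.add s2)
  obtain ⟨m, n⟩ := p
  simp only
  rcases le_total n m with h | h
  · refine le_add_of_le_of_nonneg ?_ (by positivity)
    calc _ ≤ (1 / 2 : ℝ) ^ n * (((m : ℝ) + 1) ^ α * ((n : ℝ) + 1) ^ β * (C * ((m : ℝ) + 1) ^ γ)) := by
          gcongr
          · exact fac_bound m n h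
          · exact hb m n h
      _ = _ := by rw [Real.rpow_add (by positivity)]; ring
  · refine le_add_of_nonneg_of_le (by positivity) ?_
    have f := fac_bound n m h
    rw [mul_comm (n.factorial : ℝ), add_comm n m] at f
    have g := hb n m h
    rw [add_comm (n : ℝ) m] at g
    calc _ ≤ (1 / 2 : ℝ) ^ m * (((m : ℝ) + 1) ^ α * ((n : ℝ) + 1) ^ β * (C * ((n : ℝ) + 1) ^ γ)) := by
          gcongr
      _ = _ := by rw [Real.rpow_add (by positivity)]; ring

/-- Used for the rearrangement in the Kummer transformation. -/
lemma summable_double' {P Q : ℝ} (hQ : 0 < Q) (h : 0 < P ∨ (0 < 3 * P + Q ∧ P < Q)) :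
    Summable (fun p : ℕ × ℕ => ((p.1 : ℝ) + 1) ^ (-P - 1) * ((p.2 : ℝ) + 1) ^ (P - 1) *
      ((p.1 : ℝ) + p.2 + 1) ^ (-P - Q)) := by
  obtain ⟨s, t, hs, ht, hst, h1, h2⟩ : ∃ s t : ℝ, 0 ≤ s ∧ 0 ≤ t ∧ s + t = P + Q ∧ 0 < P + s ∧ P < t := by
    by_cases hP : 0 < P
    · exact ⟨0, P + Q, le_rfl, by linarith, by ring, by linarith, by linarith⟩
    · rcases h with h | h
      · exact absurd h hP
      · exact ⟨(P + Q) / 2, (P + Q) / 2, by linarith, by linarith, by ring, by linarith, by linarith⟩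
  have s1 := (summable_pow (s := -P - 1 - s) (by linarith)).mul_of_nonneg
    (summable_pow (s := P - 1 - t) (by linarith)) (fun _ => by positivity) (fun _ => by positivity)
  refine Summable.of_nonneg_of_le (fun p => by positivity) (fun p => ?_) s1
  obtain ⟨m, n⟩ := p
  simp only
  have hm : (0 : ℝ) ≤ m := by positivity
  have hn : (0 : ℝ) ≤ n := by positivity
  have e : -P - Q = -s + -t := by linarith
  rw [e, Real.rpow_add (by positivity : (0 : ℝ) < (m : ℝ) + n + 1)]
  calc _ ≤ ((m : ℝ) + 1) ^ (-P - 1) * ((n : ℝ) + 1) ^ (P - 1) *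
        (((m : ℝ) + 1) ^ (-s) * ((n : ℝ) + 1) ^ (-t)) := by
        gcongr ?_ * (?_ * ?_)
        · exact Real.rpow_le_rpow_of_nonpos (by positivity) (by linarith) (by linarith)
        · exact Real.rpow_le_rpow_of_nonpos (by positivity) (by linarith) (by linarith)
    _ = _ := by
        rw [sub_eq_add_neg (-P - 1), sub_eq_add_neg (P - 1),
          Real.rpow_add (by positivity : (0 : ℝ) < (m : ℝ) + 1),
          Real.rpow_add (by positivity : (0 : ℝ) < (n : ℝ) + 1)]
        ring

lemma exists_nonint (x σ : ℝ) (h : σ < x) : ∃ τ : ℝ, σ < τ ∧ τ < x ∧ ∀ k : ℤ, τ ≠ k := by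
  have hc := Int.ceil_lt_add_one x
  have hl := Int.le_ceil x
  have hm : max σ ((⌈x⌉ : ℝ) - 1) < x := max_lt h (by linarith)
  obtain ⟨τ, h1, h2⟩ := exists_between hm
  refine ⟨τ, (le_max_left _ _).trans_lt h1, h2, fun k hk => ?_⟩
  have h3 := (le_max_right σ ((⌈x⌉ : ℝ) - 1)).trans_lt h1
  have h4 := h2.trans_le hl
  rw [hk] at h3 h4
  have h3' : ⌈x⌉ - 1 < k := by exact_mod_cast h3
  have h4' : k < ⌈x⌉ := by exact_mod_cast h4
  omega

lemma gamma_inv_bound (e0 : ℂ) (σ : ℝ) (h : σ < e0.re) : ∃ C : ℝ, 0 < C ∧ ∀ᶠ e in 𝓝 e0, ∀ m : ℕ,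
    ‖(Complex.Gamma (e + m))⁻¹‖ ≤ C * ((m.factorial : ℝ)⁻¹ * ((m : ℝ) + 1) ^ (1 - σ)) := by
  obtain ⟨τ, hστ, hτ, hint⟩ := exists_nonint _ _ h
  have hτn : notNonposInt (τ : ℂ) := fun k hk => by
    apply hint (-k)
    have := congrArg Complex.re hk
    simpa using this
  obtain ⟨C1, hC1, hb⟩ := poch_lower hτn
  obtain ⟨N, hN⟩ := exists_nat_gt (-τ)
  have hloc : ∀ m : ℕ, ∃ B : ℝ, ∀ᶠ e in 𝓝 e0, ‖poch τ m‖ * ‖(Complex.Gamma (e + m))⁻¹‖ ≤ B := by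
    intro m
    have hc : Continuous (fun e : ℂ => ‖poch τ m‖ * ‖(Complex.Gamma (e + m))⁻¹‖) := by
      have := Complex.differentiable_one_div_Gamma.continuous
      exact continuous_const.mul (this.comp (continuous_id.add continuous_const)).norm
    exact ⟨_, (hc.tendsto e0).eventually_le_const (lt_add_one _)⟩
  choose B hB using hloc
  have hre : ∀ᶠ e : ℂ in 𝓝 e0, τ < e.re :=
    (Complex.continuous_re.tendsto e0).eventually_const_lt hτ
  have hall : ∀ᶠ e in 𝓝 e0, ∀ m ∈ Finset.range (N + 1),
      ‖poch τ m‖ * ‖(Complex.Gamma (e + m))⁻¹‖ ≤ B m :=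
    (Filter.eventually_all_finset _).mpr fun m _ => hB m
  set B0 := ∑ m ∈ Finset.range (N + 1), |B m| + 1 with hB0
  have hB0pos : 0 < B0 := by positivity
  have hBle : ∀ m ∈ Finset.range (N + 1), B m ≤ B0 := fun m hm =>
    (le_abs_self _).trans ((Finset.single_le_sum (f := fun m => |B m|) (fun i _ => abs_nonneg _) hm).trans
      (by linarith))
  refine ⟨B0 * C1, by positivity, ?_⟩
  filter_upwards [hre, hall] with e he hm m
  have main : ∀ m : ℕ, ‖poch τ m‖ * ‖(Complex.Gamma (e + m))⁻¹‖ ≤ B0 := by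
    intro m
    rcases Nat.lt_or_ge m (N + 1) with h | h
    · exact (hm m (Finset.mem_range.mpr h)).trans (hBle m (Finset.mem_range.mpr h))
    · have hNm : N ≤ m := by omega
      clear h
      induction m, hNm using Nat.le_induction with
      | base => exact (hm N (by simp)).trans (hBle N (by simp))
      | succ k hk ih =>
        refine le_trans ?_ ih
        have hkN : (N : ℝ) ≤ k := by exact_mod_cast hk
        have hpos : 0 < (e + k).re := by simp; linarith
        have hne : e + k ≠ 0 := fun h => by rw [h] at hpos; simp at hpos
        have e1 : e + ((k + 1 : ℕ) : ℂ) = (e + k) + 1 := by push_cast; ring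
        rw [e1, Complex.Gamma_add_one _ hne, poch_succ, mul_inv, norm_mul, norm_mul, norm_inv (e + k)]
        have hle : ‖(τ : ℂ) + k‖ ≤ ‖e + k‖ := by
          have : (τ : ℂ) + k = ((τ + k : ℝ) : ℂ) := by push_cast; rfl
          rw [this, Complex.norm_real, Real.norm_eq_abs, abs_of_pos (by linarith)]
          refine le_trans ?_ (Complex.re_le_norm _)
          simp; linarith
        have hpos' : 0 < ‖e + k‖ := norm_pos_iff.mpr hne
        have : ‖(τ : ℂ) + k‖ * ‖e + k‖⁻¹ ≤ 1 := by
          rw [← div_eq_mul_inv]; exact (div_le_one hpos').mpr hle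
        calc _ = (‖(τ : ℂ) + k‖ * ‖e + k‖⁻¹) * (‖poch τ k‖ * ‖(Complex.Gamma (e + k))⁻¹‖) := by ring
          _ ≤ 1 * (‖poch τ k‖ * ‖(Complex.Gamma (e + k))⁻¹‖) := by gcongr
          _ = _ := one_mul _
  have hp : 0 < ‖poch τ m‖ := norm_pos_iff.mpr (poch_ne hτn m)
  have h1 : ‖(Complex.Gamma (e + m))⁻¹‖ ≤ B0 * ‖poch τ m‖⁻¹ := by
    rw [← div_eq_mul_inv, le_div_iff₀ hp, mul_comm]; exact main m
  refine h1.trans ?_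
  rw [mul_assoc]
  refine mul_le_mul_of_nonneg_left ((hb m).trans ?_) hB0pos.le
  gcongr
  · have : (0 : ℝ) ≤ m := by positivity
    linarith
  · simpa using hστ.le

lemma differentiableOn_tsum_local {ι : Type*} {F : ι → ℂ → ℂ} {U : Set ℂ}
    (hF : ∀ i, Differentiable ℂ (F i))
    (h : ∀ e0 ∈ U, ∃ u : ι → ℝ, Summable u ∧ ∀ᶠ e in 𝓝 e0, ∀ i, ‖F i e‖ ≤ u i) :
    DifferentiableOn ℂ (fun e => ∑' i, F i e) U := by
  intro e0 he0
  obtain ⟨u, hu, hev⟩ := h e0 he0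
  obtain ⟨V, hV, hVo, hmem⟩ := eventually_nhds_iff.mp hev
  have := Complex.differentiableOn_tsum_of_summable_norm hu (fun i => (hF i).differentiableOn) hVo
    (fun i w hw => hV w hw i)
  exact (this.differentiableAt (hVo.mem_nhds hmem)).differentiableWithinAt

lemma gauss_bound (p q : ℂ) {r : ℂ} (hr : notNonposInt r) : ∃ C : ℝ, 0 < C ∧ ∀ j : ℕ,
    ‖poch p j * poch q j / (poch r j * (j.factorial : ℂ))‖ ≤ C * ((j : ℝ) + 1) ^ (-(r - p - q).re - 1) := by
  obtain ⟨C1, h1, b1⟩ := poch_upper p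
  obtain ⟨C2, h2, b2⟩ := poch_upper q
  obtain ⟨C3, h3, b3⟩ := poch_lower hr
  refine ⟨C1 * C2 * C3, by positivity, fun j => ?_⟩
  have hf : (0 : ℝ) < j.factorial := by positivity
  have hj : (0 : ℝ) < (j : ℝ) + 1 := by positivity
  rw [norm_div, norm_mul, norm_mul, Complex.norm_natCast, div_eq_mul_inv, mul_inv]
  calc _ ≤ (C1 * ((j.factorial : ℝ) * ((j : ℝ) + 1) ^ (p.re - 1))) *
        (C2 * ((j.factorial : ℝ) * ((j : ℝ) + 1) ^ (q.re - 1))) *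
        ((C3 * ((j.factorial : ℝ)⁻¹ * ((j : ℝ) + 1) ^ (1 - r.re))) * (j.factorial : ℝ)⁻¹) := by
        gcongr
        · exact b1 j
        · exact b2 j
        · exact b3 j
    _ = C1 * C2 * C3 * (((j : ℝ) + 1) ^ (p.re - 1) * ((j : ℝ) + 1) ^ (q.re - 1) *
        ((j : ℝ) + 1) ^ (1 - r.re)) := by field_simp
    _ = _ := by
      rw [← Real.rpow_add hj, ← Real.rpow_add hj]
      congr 2
      simp; ring

lemma gauss_summable (p q : ℂ) {r : ℂ} (hr : notNonposInt r) (hs : 0 < (r - p - q).re) :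
    Summable (fun j : ℕ => poch p j * poch q j / (poch r j * (j.factorial : ℂ))) := by
  obtain ⟨C, -, hb⟩ := gauss_bound p q hr
  exact Summable.of_norm_bounded ((summable_pow (by linarith)).mul_left C) hb

lemma gauss_step (p q : ℂ) {r : ℂ} (hr : notNonposInt r) (hs : 0 < (r - p - q).re) :
    r * (r - p - q) * ∑' j : ℕ, poch p j * poch q j / (poch r j * (j.factorial : ℂ)) =
    (r - p) * (r - q) * ∑' j : ℕ, poch p j * poch q j / (poch (r + 1) j * (j.factorial : ℂ)) := by
  have hr1 : notNonposInt (r + 1) := by simpa using nn_add hr 1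
  have s1 := gauss_summable p q hr hs
  have s2 := gauss_summable p q hr1 (by simp at hs ⊢; linarith)
  set t : ℕ → ℂ := fun j => poch p j * poch q j / (poch r j * (j.factorial : ℂ)) with ht
  have htel : ∀ j : ℕ, r * (r - p - q) * t j - (r - p) * (r - q) *
      (poch p j * poch q j / (poch (r + 1) j * (j.factorial : ℂ))) =
      (-r * ((j + 1 : ℕ) : ℂ) * t (j + 1)) - (-r * (j : ℂ) * t j) := by
    intro j
    have e1 : r * poch (r + 1) j = poch r j * (r + j) := by
      have := poch_add r 1 j
      rw [add_comm 1 j, poch_succ] at this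
      simp [poch] at this ⊢
      exact this.symm
    have hr0 : r ≠ 0 := by simpa using nn_ne hr 0
    have e2 : poch (r + 1) j = poch r j * (r + j) / r := by
      rw [eq_div_iff hr0, ← e1]; ring
    have n1 := poch_ne hr j
    have n2 := nn_ne hr j
    have n3 := fac_ne j
    have n4 : (j : ℂ) + 1 ≠ 0 := Nat.cast_add_one_ne_zero _
    simp only [ht]
    rw [e2, poch_succ, poch_succ, poch_succ, Nat.factorial_succ]
    push_cast
    field_simp
    ring
  have hlim : Tendsto (fun j : ℕ => -r * (j : ℂ) * t j) atTop (𝓝 0) := by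
    obtain ⟨C, hC, hb⟩ := gauss_bound p q hr
    have h0 : Tendsto (fun j : ℕ => ‖r‖ * C * ((j : ℝ) + 1) ^ (-(r - p - q).re)) atTop (𝓝 0) := by
      have h1 : Tendsto (fun j : ℕ => (j : ℝ) + 1) atTop atTop :=
        tendsto_atTop_add_const_right _ _ tendsto_natCast_atTop_atTop
      simpa using ((tendsto_rpow_neg_atTop hs).comp h1).const_mul (‖r‖ * C)
    refine squeeze_zero_norm (fun j => ?_) h0
    have hj : (0 : ℝ) < (j : ℝ) + 1 := by positivity
    rw [norm_mul, norm_mul, norm_neg, Complex.norm_natCast]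
    calc ‖r‖ * (j : ℝ) * ‖t j‖ ≤ ‖r‖ * ((j : ℝ) + 1) * (C * ((j : ℝ) + 1) ^ (-(r - p - q).re - 1)) := by
          gcongr
          · linarith
          · exact hb j
      _ = _ := by rw [Real.rpow_sub hj, Real.rpow_one]; field_simp
  have hsum : HasSum (fun j : ℕ => r * (r - p - q) * t j - (r - p) * (r - q) *
      (poch p j * poch q j / (poch (r + 1) j * (j.factorial : ℂ)))) 0 := by
    have hs3 := ((s1.mul_left (r * (r - p - q))).sub (s2.mul_left ((r - p) * (r - q))))
    have h4 := hs3.hasSum.tendsto_sum_nat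
    have h5 : Tendsto (fun n : ℕ => ∑ j ∈ Finset.range n, (r * (r - p - q) * t j - (r - p) * (r - q) *
      (poch p j * poch q j / (poch (r + 1) j * (j.factorial : ℂ))))) atTop (𝓝 0) := by
      refine hlim.congr fun n => ?_
      rw [Finset.sum_congr rfl fun j _ => htel j, Finset.sum_range_sub (fun j : ℕ => -r * (j : ℂ) * t j)]
      simp
    have := tendsto_nhds_unique h4 h5
    rw [← this]
    exact hs3.hasSum
  have h6 := hsum.tsum_eq
  rw [(s1.mul_left _).tsum_sub (s2.mul_left _), tsum_mul_left, tsum_mul_left, sub_eq_zero] at h6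
  exact h6

lemma gauss_iter (p q : ℂ) {r : ℂ} (hr : notNonposInt r) (hs : 0 < (r - p - q).re) (N : ℕ) :
    poch r N * poch (r - p - q) N * ∑' j : ℕ, poch p j * poch q j / (poch r j * (j.factorial : ℂ)) =
    poch (r - p) N * poch (r - q) N *
      ∑' j : ℕ, poch p j * poch q j / (poch (r + N) j * (j.factorial : ℂ)) := by
  induction N with
  | zero => simp [poch_zero]
  | succ N ih =>
    have hN : (0 : ℝ) ≤ N := by positivity
    have := gauss_step p q (nn_add hr N) (by simp at hs ⊢; linarith)
    have e : r + ((N + 1 : ℕ) : ℂ) = r + N + 1 := by push_cast; ring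
    rw [poch_succ, poch_succ, poch_succ, poch_succ, e]
    calc _ = (r + N) * (r - p - q + N) * (poch r N * poch (r - p - q) N *
          ∑' j : ℕ, poch p j * poch q j / (poch r j * (j.factorial : ℂ))) := by ring
      _ = poch (r - p) N * poch (r - q) N * ((r + N) * (r + N - p - q) *
        ∑' j : ℕ, poch p j * poch q j / (poch (r + N) j * (j.factorial : ℂ))) := by rw [ih]; ring
      _ = _ := by rw [this]; ring

lemma gauss_limit (p q : ℂ) {r : ℂ} (hr : 0 < r.re) (hs : 0 < (r - p - q).re) :
    Tendsto (fun N : ℕ => ∑' j : ℕ, poch p j * poch q j / (poch (r + N) j * (j.factorial : ℂ)))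
      atTop (𝓝 1) := by
  have hrn := nn_of_re hr
  have hone : (1 : ℂ) = ∑' j : ℕ, (if j = 0 then (1 : ℂ) else 0) := by simp
  rw [hone]
  refine tendsto_tsum_of_dominated_convergence (gauss_summable p q hrn hs).norm ?_ ?_
  · intro j
    rcases j with _ | j
    · simp [poch_zero]
    · simp only [Nat.add_eq_zero_iff, one_ne_zero, and_false, if_false]
      have hinf : Tendsto (fun N : ℕ => ‖poch (r + N) (j + 1)‖) atTop atTop := by
        have hlow : Tendsto (fun N : ℕ => ‖poch r j‖ * (N : ℝ)) atTop atTop :=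
          tendsto_natCast_atTop_atTop.const_mul_atTop (norm_pos_iff.mpr (poch_ne hrn j))
        refine tendsto_atTop_mono (fun N => ?_) hlow
        rw [poch_succ, norm_mul]
        gcongr
        · rw [poch, poch, norm_prod, norm_prod]
          refine Finset.prod_le_prod (fun _ _ => norm_nonneg _) fun i _ => ?_
          rw [Complex.norm_def, Complex.norm_def]
          apply Real.sqrt_le_sqrt
          simp only [Complex.normSq_apply]
          simp
          have hN : (0 : ℝ) ≤ N := by positivity
          have hi : (0 : ℝ) ≤ i := by positivity
          nlinarith
        · refine le_trans ?_ (Complex.re_le_norm _)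
          have : (0 : ℝ) ≤ j := by positivity
          simp; linarith
      have h2 : Tendsto (fun N : ℕ => (poch (r + N) (j + 1))⁻¹) atTop (𝓝 0) := by
        rw [tendsto_zero_iff_norm_tendsto_zero]
        simp only [norm_inv]
        exact hinf.inv_tendsto_atTop
      have h3 := h2.const_mul (poch p (j + 1) * poch q (j + 1) / ((j + 1).factorial : ℂ))
      rw [mul_zero] at h3
      refine h3.congr fun N => ?_
      rw [div_mul_eq_mul_div, div_eq_div_iff_comm, ← div_eq_mul_inv]
      field_simp
  · refine Eventually.of_forall fun N j => ?_
    rw [norm_div, norm_div, norm_mul (poch (r + N) j), norm_mul (poch r j)]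
    have hp : 0 < ‖poch r j‖ := norm_pos_iff.mpr (poch_ne hrn j)
    have hf : 0 < ‖(j.factorial : ℂ)‖ := norm_pos_iff.mpr (fac_ne j)
    gcongr
    rw [poch, poch, norm_prod, norm_prod]
    refine Finset.prod_le_prod (fun _ _ => norm_nonneg _) fun i _ => ?_
    rw [Complex.norm_def, Complex.norm_def]
    apply Real.sqrt_le_sqrt
    simp only [Complex.normSq_apply]
    simp
    have hN : (0 : ℝ) ≤ N := by positivity
    have hi : (0 : ℝ) ≤ i := by positivity
    nlinarith

lemma gauss (p q : ℂ) {r : ℂ} (hr : 0 < r.re) (hs : 0 < (r - p - q).re)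
    (h3 : notNonposInt (r - p)) (h4 : notNonposInt (r - q)) :
    ∑' j : ℕ, poch p j * poch q j / (poch r j * (j.factorial : ℂ)) =
      Complex.Gamma r * Complex.Gamma (r - p - q) /
        (Complex.Gamma (r - p) * Complex.Gamma (r - q)) := by
  have h1 := nn_of_re hr
  have h2 := nn_of_re hs
  have l := ((Complex.GammaSeq_tendsto_Gamma r).mul (Complex.GammaSeq_tendsto_Gamma (r - p - q))).div
    ((Complex.GammaSeq_tendsto_Gamma (r - p)).mul (Complex.GammaSeq_tendsto_Gamma (r - q)))
    (mul_ne_zero (gamma_ne h3) (gamma_ne h4))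
  have l2 := l.mul ((tendsto_add_atTop_iff_nat 1).mpr (gauss_limit p q hr hs))
  rw [mul_one] at l2
  refine tendsto_nhds_unique (tendsto_const_nhds.congr' ?_) l2
  filter_upwards [eventually_gt_atTop 0] with n hn
  have hn' : (n : ℂ) ≠ 0 := Nat.cast_ne_zero.mpr hn.ne'
  have key := gauss_iter p q h1 hs (n + 1)
  have n1 := poch_ne h1 (n + 1)
  have n2 := poch_ne h2 (n + 1)
  have n3 := poch_ne h3 (n + 1)
  have n4 := poch_ne h4 (n + 1)
  have nf := fac_ne n
  have hp : ∀ s : ℂ, Complex.GammaSeq s n = (n : ℂ) ^ s * (n.factorial : ℂ) / poch s (n + 1) :=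
    fun s => rfl
  have hc : (n : ℂ) ^ r * (n : ℂ) ^ (r - p - q) = (n : ℂ) ^ (r - p) * (n : ℂ) ^ (r - q) := by
    rw [← Complex.cpow_add _ _ hn', ← Complex.cpow_add _ _ hn']
    congr 1; ring
  have c3 : (n : ℂ) ^ (r - p) ≠ 0 := by simp [Complex.cpow_eq_zero_iff, hn']
  have c4 : (n : ℂ) ^ (r - q) ≠ 0 := by simp [Complex.cpow_eq_zero_iff, hn']
  simp only [Pi.div_apply]
  rw [hp, hp, hp, hp]
  have ratio : (n : ℂ) ^ r * (n.factorial : ℂ) / poch r (n + 1) *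
      ((n : ℂ) ^ (r - p - q) * (n.factorial : ℂ) / poch (r - p - q) (n + 1)) /
      ((n : ℂ) ^ (r - p) * (n.factorial : ℂ) / poch (r - p) (n + 1) *
      ((n : ℂ) ^ (r - q) * (n.factorial : ℂ) / poch (r - q) (n + 1))) =
      poch (r - p) (n + 1) * poch (r - q) (n + 1) / (poch r (n + 1) * poch (r - p - q) (n + 1)) := by
    have : (n : ℂ) ^ r * (n.factorial : ℂ) / poch r (n + 1) *
      ((n : ℂ) ^ (r - p - q) * (n.factorial : ℂ) / poch (r - p - q) (n + 1)) =
      ((n : ℂ) ^ (r - p) * (n : ℂ) ^ (r - q)) * (n.factorial : ℂ) ^ 2 /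
        (poch r (n + 1) * poch (r - p - q) (n + 1)) := by
      rw [← hc]; field_simp
    rw [this]
    field_simp
  rw [ratio, div_mul_eq_mul_div, eq_div_iff (mul_ne_zero n1 n2), mul_comm]
  exact key

lemma tsum_antidiag {f : ℕ × ℕ → ℂ} (hf : Summable f) :
    ∑' p, f p = ∑' n : ℕ, ∑ p ∈ antidiagonal n, f p := by
  have h1 : Summable (fun x : Σ n : ℕ, antidiagonal n => f x.2) :=
    (Finset.HasAntidiagonal.sigmaAntidiagonalEquivProd (A := ℕ)).summable_iff.mpr hf
  rw [← (Finset.HasAntidiagonal.sigmaAntidiagonalEquivProd (A := ℕ)).tsum_eq f]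
  rw [show (∑' c, f (Finset.HasAntidiagonal.sigmaAntidiagonalEquivProd c)) =
    ∑' x : Σ n : ℕ, antidiagonal n, f x.2 from rfl]
  rw [h1.tsum_sigma' (fun n => (hasSum_fintype _).summable)]
  congr 1
  ext n
  rw [tsum_fintype]
  exact Finset.sum_coe_sort (antidiagonal n) f

lemma summable_antidiag {f : ℕ × ℕ → ℝ} (h0 : ∀ p, 0 ≤ f p)
    (hs : Summable (fun n : ℕ => ∑ p ∈ antidiagonal n, f p)) : Summable f := by
  rw [← (Finset.HasAntidiagonal.sigmaAntidiagonalEquivProd (A := ℕ)).summable_iff]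
  refine (summable_sigma_of_nonneg (fun _ => h0 _)).mpr ⟨fun n => (hasSum_fintype _).summable, ?_⟩
  refine hs.congr fun n => ?_
  rw [tsum_fintype]
  exact (Finset.sum_coe_sort (antidiagonal n) f).symm

lemma ratio_bound (c : ℂ) {r : ℂ} (hr : notNonposInt r) : ∃ C : ℝ, 0 < C ∧ ∀ j : ℕ,
    ‖poch c j / poch r j‖ ≤ C * ((j : ℝ) + 1) ^ (c.re - r.re) := by
  obtain ⟨C1, h1, b1⟩ := poch_upper c
  obtain ⟨C3, h3, b3⟩ := poch_lower hr
  refine ⟨C1 * C3, by positivity, fun j => ?_⟩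
  have hf : (0 : ℝ) < j.factorial := by positivity
  have hj : (0 : ℝ) < (j : ℝ) + 1 := by positivity
  rw [norm_div, div_eq_mul_inv]
  calc _ ≤ (C1 * ((j.factorial : ℝ) * ((j : ℝ) + 1) ^ (c.re - 1))) *
        (C3 * ((j.factorial : ℝ)⁻¹ * ((j : ℝ) + 1) ^ (1 - r.re))) := by
        gcongr
        · exact b1 j
        · exact b3 j
    _ = C1 * C3 * (((j : ℝ) + 1) ^ (c.re - 1) * ((j : ℝ) + 1) ^ (1 - r.re)) := by field_simp
    _ = _ := by
      rw [← Real.rpow_add hj]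
      congr 2
      ring

lemma coef_bound (s : ℂ) : ∃ C : ℝ, 0 < C ∧ ∀ j : ℕ,
    ‖poch s j / (j.factorial : ℂ)‖ ≤ C * ((j : ℝ) + 1) ^ (s.re - 1) := by
  obtain ⟨C1, h1, b1⟩ := poch_upper s
  refine ⟨C1, h1, fun j => ?_⟩
  rw [norm_div, Complex.norm_natCast, div_le_iff₀ (by positivity)]
  exact (b1 j).trans (le_of_eq (by ring))

lemma kummer (a b c D E : ℂ) (hD : notNonposInt D) (hQ : 0 < (E - c).re)
    (hP : 0 < (D - a - b).re ∨ (0 < 3 * (D - a - b).re + (E - c).re ∧ (D - a - b).re < (E - c).re))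
    (hE : 0 < E.re) (hr : 0 < (D + E - a - b).re) (hrc : 0 < (D + E - a - b - c).re) :
    ∑' k : ℕ, poch (D - a) k * poch (D - b) k * poch c k /
        (poch D k * poch (D + E - a - b) k * (k.factorial : ℂ)) =
      Complex.Gamma (D + E - a - b) * Complex.Gamma (E - c) /
        (Complex.Gamma E * Complex.Gamma (D + E - a - b - c)) *
      ∑' m : ℕ, poch a m * poch b m * poch c m / (poch D m * poch E m * (m.factorial : ℂ)) := by
  set r := D + E - a - b with hr_def
  have hrn := nn_of_re hr
  set W : ℕ × ℕ → ℂ := fun p => (poch a p.1 * poch b p.1 / (poch D p.1 * (p.1.factorial : ℂ))) *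
        (poch (D - a - b) p.2 / (p.2.factorial : ℂ)) * (poch c (p.1 + p.2) / poch r (p.1 + p.2)) with hW
  have hsum : Summable W := by
    obtain ⟨C1, h1, b1⟩ := gauss_bound a b hD
    obtain ⟨C2, h2, b2⟩ := coef_bound (D - a - b)
    obtain ⟨C3, h3, b3⟩ := ratio_bound c hrn
    refine Summable.of_norm_bounded ((summable_double' hQ hP).mul_left (C1 * C2 * C3)) fun p => ?_
    have e : c.re - r.re = -(D - a - b).re - (E - c).re := by rw [hr_def]; simp; ring
    have b3' := b3 (p.1 + p.2)
    rw [e] at b3'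
    push_cast at b3'
    simp only [hW]
    rw [norm_mul, norm_mul]
    calc _ ≤ (C1 * ((p.1 : ℝ) + 1) ^ (-(D - a - b).re - 1)) * (C2 * ((p.2 : ℝ) + 1) ^ ((D - a - b).re - 1)) *
          (C3 * ((p.1 : ℝ) + p.2 + 1) ^ (-(D - a - b).re - (E - c).re)) := by
          gcongr
          · exact b1 _
          · exact b2 _
      _ = _ := by ring
  have e1 : ∑' p, W p = ∑' k : ℕ, poch (D - a) k * poch (D - b) k * poch c k /
        (poch D k * poch r k * (k.factorial : ℂ)) := by
    rw [tsum_antidiag hsum]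
    congr 1
    ext k
    have : ∀ p ∈ antidiagonal k, W p =
        (poch a p.1 * poch b p.1 / (poch D p.1 * (p.1.factorial : ℂ))) *
        (poch (D - a - b) p.2 / (p.2.factorial : ℂ)) * (poch c k / poch r k) := by
      intro p hp
      simp only [hW, mem_antidiagonal.mp hp]
    rw [Finset.sum_congr rfl this, ← Finset.sum_mul, saalschutz a b D hD k]
    have n1 := poch_ne hD k
    have n2 := poch_ne hrn k
    have n3 := fac_ne k
    field_simp
  have e2 : ∑' p, W p = ∑' m : ℕ, (Complex.Gamma r * Complex.Gamma (E - c) /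
        (Complex.Gamma E * Complex.Gamma (r - c))) *
      (poch a m * poch b m * poch c m / (poch D m * poch E m * (m.factorial : ℂ))) := by
    rw [hsum.tsum_prod]
    congr 1
    ext m
    have hm : (0 : ℝ) ≤ m := by positivity
    have hg := gauss (D - a - b) (c + m) (r := r + m) (by simp at hr ⊢; linarith)
      (by rw [hr_def]; simp at hQ ⊢; linarith)
      (nn_of_re (by rw [hr_def]; simp at hE ⊢; linarith))
      (nn_of_re (by simp at hrc ⊢; linarith))
    have f1 : r + m - (D - a - b) - (c + m) = E - c := by rw [hr_def]; ring
    have f2 : r + m - (D - a - b) = E + m := by rw [hr_def]; ring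
    have f3 : r + m - (c + m) = r - c := by ring
    rw [f1, f2, f3, poch_gamma hrn, poch_gamma (nn_of_re hE)] at hg
    have : ∀ j : ℕ, W (m, j) = (poch a m * poch b m * poch c m / (poch D m * poch r m * (m.factorial : ℂ))) *
        (poch (D - a - b) j * poch (c + m) j / (poch (r + m) j * (j.factorial : ℂ))) := by
      intro j
      simp only [hW]
      rw [poch_add c, poch_add r]
      have n1 := poch_ne hD m
      have n2 := poch_ne hrn m
      have n3 := fac_ne m
      have n4 := fac_ne j
      have n5 := poch_ne (nn_add hrn m) j
      field_simp
    rw [tsum_congr this, tsum_mul_left, hg]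
    have n1 := poch_ne hD m
    have n2 := poch_ne hrn m
    have n3 := fac_ne m
    have n4 := poch_ne (nn_of_re hE) m
    have n5 := gamma_ne (nn_of_re hE)
    have n6 := gamma_ne (nn_of_re hrc)
    field_simp
  rw [← e1, e2, tsum_mul_left]

/-- The regularised summand of the double series (without the Gamma factors). -/
noncomputable def coefN (a b c c' d : ℂ) (p : ℕ × ℕ) : ℂ :=
  poch a p.1 * poch b p.1 * poch c p.1 * poch (d - a) p.2 * poch (d - b) p.2 * poch c' p.2 /
    (poch d (p.1 + p.2) * (p.1.factorial : ℂ) * (p.2.factorial : ℂ))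

noncomputable def regL (a b c c' d : ℂ) (p : ℕ × ℕ) (e : ℂ) : ℂ :=
  coefN a b c c' d p * (Complex.Gamma (e + p.1))⁻¹ * (Complex.Gamma (e + (d - a - b - c) + p.2))⁻¹

noncomputable def regR (a b c c' d : ℂ) (k : ℕ) (e : ℂ) : ℂ :=
  poch (d - a) k * poch (d - b) k * poch (c + c') k / (poch d k * (k.factorial : ℂ)) *
    (Complex.Gamma (e + (d - a - b) + k))⁻¹

lemma three_bound (x y z : ℂ) : ∃ C : ℝ, 0 < C ∧ ∀ k : ℕ,
    ‖poch x k * poch y k * poch z k‖ ≤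
      C * ((k.factorial : ℝ) ^ 3 * ((k : ℝ) + 1) ^ (x.re + y.re + z.re - 3)) := by
  obtain ⟨C1, h1, b1⟩ := poch_upper x
  obtain ⟨C2, h2, b2⟩ := poch_upper y
  obtain ⟨C3, h3, b3⟩ := poch_upper z
  refine ⟨C1 * C2 * C3, by positivity, fun k => ?_⟩
  have hk : (0 : ℝ) < (k : ℝ) + 1 := by positivity
  rw [norm_mul, norm_mul]
  calc _ ≤ (C1 * ((k.factorial : ℝ) * ((k : ℝ) + 1) ^ (x.re - 1))) *
        (C2 * ((k.factorial : ℝ) * ((k : ℝ) + 1) ^ (y.re - 1))) *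
        (C3 * ((k.factorial : ℝ) * ((k : ℝ) + 1) ^ (z.re - 1))) := by
        gcongr
        · exact b1 k
        · exact b2 k
        · exact b3 k
    _ = C1 * C2 * C3 * ((k.factorial : ℝ) ^ 3 * (((k : ℝ) + 1) ^ (x.re - 1) *
        ((k : ℝ) + 1) ^ (y.re - 1) * ((k : ℝ) + 1) ^ (z.re - 1))) := by ring
    _ = _ := by
      rw [← Real.rpow_add hk, ← Real.rpow_add hk]
      congr 3
      ring

lemma gamma_inv_bound' (e0 t : ℂ) (σ : ℝ) (h : σ < (e0 + t).re) : ∃ C : ℝ, 0 < C ∧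
    ∀ᶠ e in 𝓝 e0, ∀ m : ℕ,
    ‖(Complex.Gamma (e + t + m))⁻¹‖ ≤ C * ((m.factorial : ℝ)⁻¹ * ((m : ℝ) + 1) ^ (1 - σ)) := by
  obtain ⟨C, hC, hb⟩ := gamma_inv_bound (e0 + t) σ h
  refine ⟨C, hC, ?_⟩
  have : Tendsto (fun e : ℂ => e + t) (𝓝 e0) (𝓝 (e0 + t)) :=
    (continuous_id.add continuous_const).tendsto e0
  exact this.eventually hb

lemma regL_dom (a b c c' d e0 : ℂ) (hd : notNonposInt d)
    (h1 : 0 < (d + e0 - a - b - c).re) (h2 : 0 < (e0 - c - c').re) :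
    ∃ u : ℕ × ℕ → ℝ, Summable u ∧ ∀ᶠ e in 𝓝 e0, ∀ p, ‖regL a b c c' d p e‖ ≤ u p := by
  obtain ⟨σ, hσ1, hσ2⟩ : ∃ σ, (a + b + c - d).re < σ ∧ σ < e0.re :=
    exists_between (by simp at h1 ⊢; linarith)
  obtain ⟨τ, hτ1, hτ2⟩ : ∃ τ, (d - a - b + c').re < τ ∧ τ < (e0 + (d - a - b - c)).re :=
    exists_between (by simp at h2 ⊢; linarith)
  obtain ⟨C1, p1, b1⟩ := three_bound a b c
  obtain ⟨C2, p2, b2⟩ := three_bound (d - a) (d - b) c'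
  obtain ⟨C3, p3, b3⟩ := poch_lower hd
  obtain ⟨C4, p4, b4⟩ := gamma_inv_bound e0 σ hσ2
  obtain ⟨C5, p5, b5⟩ := gamma_inv_bound' e0 _ τ hτ2
  refine ⟨_, (summable_double (α := a.re + b.re + c.re - 3 + (1 - σ))
    (β := (d - a).re + (d - b).re + c'.re - 3 + (1 - τ)) (γ := 1 - d.re) ?_ ?_).mul_left
      (C1 * C2 * C3 * C4 * C5), ?_⟩
  · simp at hσ1; linarith
  · simp at hτ1 ⊢; linarith
  filter_upwards [b4, b5] with e c4 c5 p
  obtain ⟨m, n⟩ := p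
  have hm : (0 : ℝ) < (m : ℝ) + 1 := by positivity
  have hn : (0 : ℝ) < (n : ℝ) + 1 := by positivity
  have fm : (0 : ℝ) < m.factorial := by positivity
  have fn : (0 : ℝ) < n.factorial := by positivity
  have fmn : (0 : ℝ) < (m + n).factorial := by positivity
  have b3' := b3 (m + n)
  push_cast at b3'
  have e1 : ‖regL a b c c' d (m, n) e‖ = ‖poch a m * poch b m * poch c m‖ *
      ‖poch (d - a) n * poch (d - b) n * poch c' n‖ * ‖poch d (m + n)‖⁻¹ *
      (m.factorial : ℝ)⁻¹ * (n.factorial : ℝ)⁻¹ * ‖(Complex.Gamma (e + m))⁻¹‖ *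
      ‖(Complex.Gamma (e + (d - a - b - c) + n))⁻¹‖ := by
    simp only [regL, coefN, norm_mul, norm_div, Complex.norm_natCast]
    field_simp
  rw [e1]
  calc _ ≤ (C1 * ((m.factorial : ℝ) ^ 3 * ((m : ℝ) + 1) ^ (a.re + b.re + c.re - 3))) *
      (C2 * ((n.factorial : ℝ) ^ 3 * ((n : ℝ) + 1) ^ ((d - a).re + (d - b).re + c'.re - 3))) *
      (C3 * (((m + n).factorial : ℝ)⁻¹ * ((m : ℝ) + n + 1) ^ (1 - d.re))) *
      (m.factorial : ℝ)⁻¹ * (n.factorial : ℝ)⁻¹ *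
      (C4 * ((m.factorial : ℝ)⁻¹ * ((m : ℝ) + 1) ^ (1 - σ))) *
      (C5 * ((n.factorial : ℝ)⁻¹ * ((n : ℝ) + 1) ^ (1 - τ))) := by
        gcongr
        · exact b1 m
        · exact b2 n
        · exact c4 m
        · exact c5 n
    _ = _ := by
      rw [Real.rpow_add hm, Real.rpow_add hn]
      simp only
      field_simp

lemma regR_dom (a b c c' d e0 : ℂ) (hd : notNonposInt d) (h2 : 0 < (e0 - c - c').re) :
    ∃ u : ℕ → ℝ, Summable u ∧ ∀ᶠ e in 𝓝 e0, ∀ k, ‖regR a b c c' d k e‖ ≤ u k := by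
  obtain ⟨σ, hσ1, hσ2⟩ : ∃ σ, (d - a - b + c + c').re < σ ∧ σ < (e0 + (d - a - b)).re :=
    exists_between (by simp at h2 ⊢; linarith)
  obtain ⟨C1, p1, b1⟩ := three_bound (d - a) (d - b) (c + c')
  obtain ⟨C3, p3, b3⟩ := poch_lower hd
  obtain ⟨C4, p4, b4⟩ := gamma_inv_bound' e0 _ σ hσ2
  refine ⟨_, (summable_pow (s := ((d - a).re + (d - b).re + (c + c').re - 3) + (1 - d.re) + (1 - σ))
    ?_).mul_left (C1 * C3 * C4), ?_⟩
  · simp at hσ1 ⊢; linarith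
  filter_upwards [b4] with e c4 k
  have hk : (0 : ℝ) < (k : ℝ) + 1 := by positivity
  have fk : (0 : ℝ) < k.factorial := by positivity
  have e1 : ‖regR a b c c' d k e‖ = ‖poch (d - a) k * poch (d - b) k * poch (c + c') k‖ *
      ‖poch d k‖⁻¹ * (k.factorial : ℝ)⁻¹ * ‖(Complex.Gamma (e + (d - a - b) + k))⁻¹‖ := by
    simp only [regR, norm_mul, norm_div, Complex.norm_natCast]
    field_simp
  rw [e1]
  calc _ ≤ (C1 * ((k.factorial : ℝ) ^ 3 * ((k : ℝ) + 1) ^ ((d - a).re + (d - b).re + (c + c').re - 3))) *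
      (C3 * ((k.factorial : ℝ)⁻¹ * ((k : ℝ) + 1) ^ (1 - d.re))) * (k.factorial : ℝ)⁻¹ *
      (C4 * ((k.factorial : ℝ)⁻¹ * ((k : ℝ) + 1) ^ (1 - σ))) := by
        gcongr
        · exact b1 k
        · exact b3 k
        · exact c4 k
    _ = _ := by
      rw [Real.rpow_add hk, Real.rpow_add hk]
      field_simp

lemma inv_gamma_diff (t : ℂ) : Differentiable ℂ (fun e : ℂ => (Complex.Gamma (e + t))⁻¹) :=
  Complex.differentiable_one_div_Gamma.comp (differentiable_id.add_const t)

lemma regL_diff (a b c c' d : ℂ) (p : ℕ × ℕ) : Differentiable ℂ (regL a b c c' d p) := by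
  have h2 := inv_gamma_diff ((d - a - b - c) + p.2)
  simp only [← add_assoc] at h2
  exact ((inv_gamma_diff p.1).const_mul _).mul h2

lemma regR_diff (a b c c' d : ℂ) (k : ℕ) : Differentiable ℂ (regR a b c c' d k) := by
  have h2 := inv_gamma_diff ((d - a - b) + k)
  simp only [← add_assoc] at h2
  exact h2.const_mul _

noncomputable def termT (a b c c' d e e' : ℂ) (m n : ℕ) : ℂ :=
  poch a m * poch b m * poch c m * poch (d - a) n * poch (d - b) n * poch c' n /
          (poch d (m + n) * poch e m * poch e' n *
            (Nat.factorial m : ℂ) * (Nat.factorial n : ℂ))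

lemma termT_eq (a b c c' d e : ℂ) (hd : notNonposInt d) (he : notNonposInt e)
    (hee : notNonposInt (e + (d - a - b - c))) (p : ℕ × ℕ) :
    termT a b c c' d e (e + (d - a - b - c)) p.1 p.2 =
      Complex.Gamma e * Complex.Gamma (e + (d - a - b - c)) * regL a b c c' d p e := by
  rw [regL, coefN, termT, poch_gamma he, poch_gamma hee]
  have n1 := poch_ne hd (p.1 + p.2)
  have n2 := poch_ne he p.1
  have n3 := poch_ne hee p.2
  have n4 := gamma_ne he
  have n5 := gamma_ne hee
  have n6 := fac_ne p.1
  have n7 := fac_ne p.2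
  field_simp

lemma termR_eq (a b c c' d e : ℂ) (hd : notNonposInt d)
    (hr : notNonposInt (e + (d - a - b))) (k : ℕ) :
    poch (d - a) k * poch (d - b) k * poch (c + c') k /
            (poch d k * poch (e + (d - a - b)) k * (Nat.factorial k : ℂ)) =
      Complex.Gamma (e + (d - a - b)) * regR a b c c' d k e := by
  rw [regR, poch_gamma hr]
  have n1 := poch_ne hd k
  have n2 := poch_ne hr k
  have n4 := gamma_ne hr
  have n6 := fac_ne k
  field_simp

lemma termT_summable (a b c c' d e : ℂ) (hd : notNonposInt d) (he : notNonposInt e)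
    (hee : notNonposInt (e + (d - a - b - c)))
    (h1 : 0 < (d + e - a - b - c).re) (h2 : 0 < (e - c - c').re) :
    Summable (fun p : ℕ × ℕ => termT a b c c' d e (e + (d - a - b - c)) p.1 p.2) := by
  obtain ⟨u, hu, hb⟩ := regL_dom a b c c' d e hd h1 h2
  have := (Summable.of_norm_bounded hu hb.self_of_nhds).mul_left
    (Complex.Gamma e * Complex.Gamma (e + (d - a - b - c)))
  exact this.congr fun p => (termT_eq a b c c' d e hd he hee p).symm

lemma hyper3_summable (x y z : ℂ) {u v : ℂ} (hu : notNonposInt u) (hv : notNonposInt v)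
    (h : 0 < (u + v - x - y - z).re) :
    Summable (fun k : ℕ => ‖poch x k * poch y k / (poch u k * poch v k)‖ *
      ‖poch z k / (k.factorial : ℂ)‖) := by
  obtain ⟨C1, h1, b1⟩ := gauss_bound x y hu
  obtain ⟨C2, h2, b2⟩ := ratio_bound z hv
  refine Summable.of_nonneg_of_le (fun k => by positivity) (fun k => ?_)
    ((summable_pow (s := (-(u - x - y).re - 1) + (z.re - v.re)) ?_).mul_left (C1 * C2))
  · have hk : (0 : ℝ) < (k : ℝ) + 1 := by positivity
    rw [Real.rpow_add hk, ← norm_mul]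
    calc _ = ‖poch x k * poch y k / (poch u k * (k.factorial : ℂ))‖ * ‖poch z k / poch v k‖ := by
          rw [← norm_mul]; congr 1; ring
      _ ≤ (C1 * ((k : ℝ) + 1) ^ (-(u - x - y).re - 1)) * (C2 * ((k : ℝ) + 1) ^ (z.re - v.re)) := by
          gcongr
          · exact b1 k
          · exact b2 k
      _ = _ := by ring
  · simp at h ⊢; linarith

lemma poch_norm_le (c : ℂ) (k : ℕ) : ‖poch c k‖ ≤ ∏ i ∈ Finset.range k, (‖c‖ + i) := by
  rw [poch, norm_prod]
  refine Finset.prod_le_prod (fun _ _ => norm_nonneg _) fun i _ => ?_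
  refine (norm_add_le _ _).trans ?_
  rw [Complex.norm_natCast]

lemma poch_real (x : ℝ) (k : ℕ) : poch (x : ℂ) k = ((∏ i ∈ Finset.range k, (x + i) : ℝ) : ℂ) := by
  simp [poch]

lemma vandermonde_summable (A : ℕ → ℂ) (c c' : ℂ)
    (h : Summable (fun k : ℕ => ‖A k‖ * ‖poch ((‖c‖ : ℂ) + ‖c'‖) k / (k.factorial : ℂ)‖)) :
    Summable (fun p : ℕ × ℕ => A (p.1 + p.2) * ((poch c p.1 / (p.1.factorial : ℂ)) *
      (poch c' p.2 / (p.2.factorial : ℂ)))) := by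
  set R : ℝ → ℕ → ℝ := fun x k => ∏ i ∈ Finset.range k, (x + i) with hR
  have hRnn : ∀ x, 0 ≤ x → ∀ k, 0 ≤ R x k := fun x hx k => Finset.prod_nonneg fun i _ => by positivity
  refine Summable.of_norm_bounded (g := fun p : ℕ × ℕ => ‖A (p.1 + p.2)‖ *
    ((R ‖c‖ p.1 / (p.1.factorial : ℝ)) * (R ‖c'‖ p.2 / (p.2.factorial : ℝ)))) ?_ ?_
  · refine summable_antidiag (fun p => ?_) ?_
    · have := hRnn ‖c‖ (norm_nonneg _) p.1
      have := hRnn ‖c'‖ (norm_nonneg _) p.2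
      positivity
    · refine h.congr fun k => ?_
      have e1 : ∀ p ∈ antidiagonal k, ‖A (p.1 + p.2)‖ *
          ((R ‖c‖ p.1 / (p.1.factorial : ℝ)) * (R ‖c'‖ p.2 / (p.2.factorial : ℝ))) = ‖A k‖ *
          ((R ‖c‖ p.1 / (p.1.factorial : ℝ)) * (R ‖c'‖ p.2 / (p.2.factorial : ℝ))) := fun p hp => by
        rw [mem_antidiagonal.mp hp]
      rw [Finset.sum_congr rfl e1, ← Finset.mul_sum]
      have hv := vandermonde (‖c‖ : ℂ) (‖c'‖ : ℂ) k
      have e2 : ((‖c‖ : ℂ) + ‖c'‖) = ((‖c‖ + ‖c'‖ : ℝ) : ℂ) := by push_cast; rfl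
      rw [e2] at hv ⊢
      simp only [poch_real] at hv ⊢
      have hv' : ∑ p ∈ antidiagonal k, (R ‖c‖ p.1 / (p.1.factorial : ℝ)) *
          (R ‖c'‖ p.2 / (p.2.factorial : ℝ)) = R (‖c‖ + ‖c'‖) k / (k.factorial : ℝ) := by
        simp only [hR]
        exact_mod_cast hv
      rw [hv', norm_div, Complex.norm_natCast, Complex.norm_real, Real.norm_of_nonneg]
      exact hRnn _ (by positivity) k
  · intro p
    rw [norm_mul, norm_mul, norm_div, norm_div, Complex.norm_natCast, Complex.norm_natCast]
    have h1 := poch_norm_le c p.1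
    have h2 := poch_norm_le c' p.2
    have := hRnn ‖c‖ (norm_nonneg _) p.1
    gcongr

lemma main_large (a b c c' d e : ℂ) (hd : notNonposInt d)
    (h1 : 0 < (d + e - a - b - c).re) (h2 : 0 < (e - c - c').re)
    (he : 0 < e.re) (hQ : 0 < (e - c).re) (hr : 0 < (e + (d - a - b)).re)
    (hPQ : 0 < 3 * (d - a - b).re + (e - c).re) (hn : ‖c‖ + ‖c'‖ < e.re) :
    ∑' p : ℕ × ℕ, regL a b c c' d p e =
      (Complex.Gamma (e - c))⁻¹ * ∑' k : ℕ, regR a b c c' d k e := by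
  have hen := nn_of_re he
  have hrn := nn_of_re hr
  have hee : notNonposInt (e + (d - a - b - c)) := nn_of_re (by simp at h1 ⊢; linarith)
  have hTs := termT_summable a b c c' d e hd hen hee h1 h2
  set r := e + (d - a - b) with hr_def
  set e' := e + (d - a - b - c) with he'_def
  set A : ℕ → ℂ := fun k => poch (d - a) k * poch (d - b) k / (poch d k * poch r k) with hA
  have hsum := vandermonde_summable A c' c (by
    refine hyper3_summable (d - a) (d - b) _ hd hrn ?_
    rw [hr_def]; simp; linarith)
  have e1 : ∑' k : ℕ, poch (d - a) k * poch (d - b) k * poch (c + c') k /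
            (poch d k * poch r k * (Nat.factorial k : ℂ)) =
      ∑' n : ℕ, ∑' j : ℕ, A (n + j) * ((poch c' n / (n.factorial : ℂ)) *
      (poch c j / (j.factorial : ℂ))) := by
    have := tsum_antidiag hsum
    rw [hsum.tsum_prod] at this
    rw [this]
    congr 1
    ext k
    have e2 : ∀ p ∈ antidiagonal k, A (p.1 + p.2) * ((poch c' p.1 / (p.1.factorial : ℂ)) *
      (poch c p.2 / (p.2.factorial : ℂ))) = A k * ((poch c' p.1 / (p.1.factorial : ℂ)) *
      (poch c p.2 / (p.2.factorial : ℂ))) := fun p hp => by rw [mem_antidiagonal.mp hp]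
    rw [Finset.sum_congr rfl e2, ← Finset.mul_sum, vandermonde, add_comm c' c]
    simp only [hA]
    have n1 := poch_ne hd k
    have n2 := poch_ne hrn k
    have n3 := fac_ne k
    field_simp
  have e2 : ∀ n : ℕ, ∑' j : ℕ, A (n + j) * ((poch c' n / (n.factorial : ℂ)) *
      (poch c j / (j.factorial : ℂ))) =
      (Complex.Gamma r * Complex.Gamma (e - c) / (Complex.Gamma e * Complex.Gamma e')) *
        ∑' m : ℕ, termT a b c c' d e e' m n := by
    intro n
    have hn0 : (0 : ℝ) ≤ n := by positivity
    have hk := kummer a b c (d + n) e (nn_add hd n) hQ (by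
        by_cases hp : 0 < (d + n - a - b).re
        · exact Or.inl hp
        · refine Or.inr ⟨?_, by linarith⟩
          simp at hPQ ⊢; linarith) he
        (by rw [hr_def] at hr; simp at hr ⊢; linarith) (by simp at h1 ⊢; linarith)
    have f1 : d + n + e - a - b = r + n := by rw [hr_def]; ring
    have f2 : r + n - c = e' + n := by rw [hr_def, he'_def]; ring
    have f3 : d + n - a = d - a + n := by ring
    have f4 : d + n - b = d - b + n := by ring
    rw [f1, f2, f3, f4, poch_gamma hrn, poch_gamma hee] at hk
    have g1 : ∀ j : ℕ, A (n + j) * ((poch c' n / (n.factorial : ℂ)) *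
      (poch c j / (j.factorial : ℂ))) =
      (poch (d - a) n * poch (d - b) n * poch c' n / (poch d n * poch r n * (n.factorial : ℂ))) *
      (poch (d - a + n) j * poch (d - b + n) j * poch c j /
        (poch (d + n) j * poch (r + n) j * (j.factorial : ℂ))) := by
      intro j
      simp only [hA]
      rw [poch_add (d - a), poch_add (d - b), poch_add d, poch_add r]
      have n1 := poch_ne hd n
      have n2 := poch_ne hrn n
      have n3 := poch_ne (nn_add hd n) j
      have n4 := poch_ne (nn_add hrn n) j
      have n5 := fac_ne n
      have n6 := fac_ne j
      field_simp
    have g2 : ∀ m : ℕ, termT a b c c' d e e' m n =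
      (poch (d - a) n * poch (d - b) n * poch c' n / (poch d n * poch e' n * (n.factorial : ℂ))) *
      (poch a m * poch b m * poch c m / (poch (d + n) m * poch e m * (m.factorial : ℂ))) := by
      intro m
      rw [termT, add_comm m n, poch_add d]
      have n1 := poch_ne hd n
      have n2 := poch_ne hee n
      have n3 := poch_ne (nn_add hd n) m
      have n4 := poch_ne hen m
      have n5 := fac_ne n
      have n6 := fac_ne m
      field_simp
    rw [tsum_congr g1, tsum_congr g2, tsum_mul_left, tsum_mul_left, hk]
    have n1 := poch_ne hd n
    have n2 := poch_ne hee n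
    have n3 := poch_ne hrn n
    have n4 := gamma_ne hen
    have n5 := gamma_ne hee
    have n6 := fac_ne n
    field_simp
  have e3 : ∑' n : ℕ, ∑' m : ℕ, termT a b c c' d e e' m n =
      Complex.Gamma e * Complex.Gamma e' * ∑' p : ℕ × ℕ, regL a b c c' d p e := by
    rw [hTs.tsum_comm (f := fun m n => termT a b c c' d e e' m n)]
    rw [← hTs.tsum_prod, ← tsum_mul_left]
    exact tsum_congr fun p => termT_eq a b c c' d e hd hen hee p
  have e4 : ∑' k : ℕ, poch (d - a) k * poch (d - b) k * poch (c + c') k /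
            (poch d k * poch r k * (Nat.factorial k : ℂ)) =
      Complex.Gamma r * ∑' k : ℕ, regR a b c c' d k e := by
    rw [← tsum_mul_left]
    exact tsum_congr fun k => termR_eq a b c c' d e hd hrn k
  rw [tsum_congr e2, tsum_mul_left, e3, e4] at e1
  have n1 := gamma_ne hrn
  have n2 := gamma_ne (nn_of_re hQ)
  have n4 := gamma_ne hen
  have n5 := gamma_ne hee
  have e5 : Complex.Gamma r * ∑' k : ℕ, regR a b c c' d k e =
      Complex.Gamma r * (Complex.Gamma (e - c) * ∑' p : ℕ × ℕ, regL a b c c' d p e) := by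
    rw [e1]; field_simp
  rw [mul_left_cancel₀ n1 e5, inv_mul_cancel_left₀ n2]

lemma main_reg (a b c c' d e : ℂ) (hd : notNonposInt d)
    (h1 : 0 < (d + e - a - b - c).re) (h2 : 0 < (e - c - c').re) :
    ∑' p : ℕ × ℕ, regL a b c c' d p e =
      (Complex.Gamma (e - c))⁻¹ * ∑' k : ℕ, regR a b c c' d k e := by
  set σ := max (a + b + c - d).re (c + c').re with hσ
  set U : Set ℂ := {z | σ < z.re} with hU
  have hUo : IsOpen U := isOpen_lt continuous_const Complex.continuous_re
  have hUc : IsPreconnected U := (convex_halfSpace_re_gt σ).isPreconnected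
  have hmem : ∀ z ∈ U, 0 < (d + z - a - b - c).re ∧ 0 < (z - c - c').re := by
    intro z hz
    have hz : σ < z.re := hz
    have z1 := (le_max_left _ _).trans_lt hz
    have z2 := (le_max_right _ _).trans_lt hz
    simp at z1 z2 ⊢
    constructor <;> linarith
  have heU : e ∈ U := by
    show max (a + b + c - d).re (c + c').re < e.re
    refine max_lt ?_ ?_
    · simp at h1 ⊢; linarith
    · simp at h2 ⊢; linarith
  have dL : DifferentiableOn ℂ (fun z => ∑' p : ℕ × ℕ, regL a b c c' d p z) U :=
    differentiableOn_tsum_local (regL_diff a b c c' d) fun z hz =>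
      regL_dom a b c c' d z hd (hmem z hz).1 (hmem z hz).2
  have dR : DifferentiableOn ℂ (fun z => (Complex.Gamma (z - c))⁻¹ * ∑' k : ℕ, regR a b c c' d k z) U := by
    refine DifferentiableOn.mul ?_ (differentiableOn_tsum_local (regR_diff a b c c' d) fun z hz =>
      regR_dom a b c c' d z hd (hmem z hz).2)
    have := (inv_gamma_diff (-c)).differentiableOn (s := U)
    simpa [sub_eq_add_neg] using this
  set R : ℝ := |σ| + |c.re| + 3 * |(d - a - b).re| + ‖c‖ + ‖c'‖ with hR
  have hlarge : ∀ z : ℂ, R < z.re → ∑' p : ℕ × ℕ, regL a b c c' d p z =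
      (Complex.Gamma (z - c))⁻¹ * ∑' k : ℕ, regR a b c c' d k z := by
    intro z hz
    have i1 := le_abs_self σ
    have i2 := le_abs_self c.re
    have i3 := neg_abs_le (d - a - b).re
    have i4 := norm_nonneg c
    have i5 := norm_nonneg c'
    have i6 := abs_nonneg σ
    have i7 := abs_nonneg c.re
    have i8 := abs_nonneg (d - a - b).re
    have hz' : z ∈ U := by
      show σ < z.re
      linarith
    refine main_large a b c c' d z hd (hmem z hz').1 (hmem z hz').2 ?_ ?_ ?_ ?_ ?_
    · linarith
    · rw [Complex.sub_re]; linarith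
    · rw [Complex.add_re]; linarith
    · rw [Complex.sub_re z c]; linarith
    · linarith
  have hz0 : ((R + 1 : ℝ) : ℂ) ∈ U := by
    show σ < ((R + 1 : ℝ) : ℂ).re
    rw [Complex.ofReal_re]
    have i1 := le_abs_self σ
    have : 0 ≤ |c.re| + 3 * |(d - a - b).re| + ‖c‖ + ‖c'‖ := by positivity
    linarith
  have hev : (fun z => ∑' p : ℕ × ℕ, regL a b c c' d p z) =ᶠ[𝓝 ((R + 1 : ℝ) : ℂ)]
      (fun z => (Complex.Gamma (z - c))⁻¹ * ∑' k : ℕ, regR a b c c' d k z) := by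
    have : ∀ᶠ z : ℂ in 𝓝 ((R + 1 : ℝ) : ℂ), R < z.re :=
      (Complex.continuous_re.tendsto _).eventually_const_lt (by simp)
    exact this.mono fun z hz => hlarge z hz
  exact (dL.analyticOnNhd hUo).eqOn_of_preconnected_of_eventuallyEq (dR.analyticOnNhd hUo) hUc hz0 hev heU

theorem kdf_to_3F2 (a b c c' d e a' b' e' : ℂ)
    (he' : e' = d + e - a - b - c) (ha' : a' = d - a) (hb' : b' = d - b)
    (h1 : 0 < (d + e - a - b - c).re) (h2 : 0 < (e - c - c').re)
    (hd : notNonposInt d) (he : notNonposInt e) (hee : notNonposInt e')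
    (hd1 : notNonposInt (e' + c)) :
    (∑' (m : ℕ) (n : ℕ),
        poch a m * poch b m * poch c m * poch a' n * poch b' n * poch c' n /
          (poch d (m + n) * poch e m * poch e' n *
            (Nat.factorial m : ℂ) * (Nat.factorial n : ℂ))) =
      Complex.Gamma e * Complex.Gamma e' /
          (Complex.Gamma (e - c) * Complex.Gamma (e' + c)) *
        ∑' (k : ℕ),
          poch (d - a) k * poch (d - b) k * poch (c + c') k /
            (poch d k * poch (e' + c) k * (Nat.factorial k : ℂ)) := by
  have f1 : e' = e + (d - a - b - c) := by rw [he']; ring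
  have f2 : e' + c = e + (d - a - b) := by rw [he']; ring
  rw [f2] at hd1 ⊢
  subst ha' hb'
  clear he'
  subst f1
  have hs := termT_summable a b c c' d e hd he hee h1 h2
  have e1 := hs.tsum_prod
  rw [tsum_congr (termT_eq a b c c' d e hd he hee), tsum_mul_left,
    main_reg a b c c' d e hd h1 h2] at e1
  simp only [termT] at e1
  rw [← e1, tsum_congr (termR_eq a b c c' d e hd hd1), tsum_mul_left]
  have n1 := gamma_ne hd1
  rw [div_eq_mul_inv, mul_inv]
  field_simp
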